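/- Let f₁, f₂ : ℝ → ℂ be infinitely differentiable functions with compact supports that are disjoint (tsupport f₁ ∩ tsupport f₂ = ∅), and let β ∈ ℝ. Set f_β = f₁ + e^{iβ} f₂ and let F_β(x) = (1/√(2π)) ∫ f_β(y) e^{-ixy} dy. Then for every integer n ≥ 0, ∫ xⁿ |F_β(x)|² dx = ∫ xⁿ (|F₁(x)|² + |F₂(x)|²) dx, where F₁, F₂ are the Fourier transforms of f₁, f₂; in particular, the moments of the density P_β(x) = |F_β(x)|² do not depend on β. -/

import Mathlib

open MeasureTheory Real Complex
open scoped ComplexConjugate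
open scoped SchwartzMap FourierTransform

/-- Weighted products of Schwartz functions are integrable. -/
theorem SchwartzMap.integrable_pow_mul_conj_mul (f g : 𝓢(ℝ, ℂ)) (n : ℕ) :
    Integrable fun x : ℝ => (x : ℂ) ^ n * (conj (f x) * g x) := by
  refine ((g.integrable_pow_mul volume n).const_mul (SchwartzMap.seminorm ℝ 0 0 f)).mono'
    ?_ (Filter.Eventually.of_forall fun x => ?_)
  · have hf := f.continuous
    have hg := g.continuous
    exact Continuous.aestronglyMeasurable (by fun_prop)
  · rw [norm_mul, norm_mul, norm_pow, RCLike.norm_conj, Complex.norm_real, mul_left_comm]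
    exact mul_le_mul_of_nonneg_right (f.norm_le_seminorm ℝ x) (by positivity)

theorem SchwartzMap.fourier_derivCLM_apply (g : 𝓢(ℝ, ℂ)) (x : ℝ) :
    𝓕 (SchwartzMap.derivCLM ℂ ℂ g) x = 2 * π * I * x * 𝓕 g x := by
  have hderiv : ⇑(SchwartzMap.derivCLM ℂ ℂ g) = deriv g := by
    ext y
    exact SchwartzMap.derivCLM_apply ℂ g y
  have hint : Integrable (deriv g) := hderiv ▸ (SchwartzMap.derivCLM ℂ ℂ g).integrable
  rw [SchwartzMap.fourier_coe, hderiv, Real.fourier_deriv g.integrable g.differentiable hint,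
    SchwartzMap.fourier_coe]
  rfl

/-- The Fourier transforms of Schwartz functions with disjoint supports are orthogonal with
respect to every power weight. -/
theorem SchwartzMap.integral_pow_mul_conj_fourier_mul_fourier_eq_zero (f : 𝓢(ℝ, ℂ)) (n : ℕ) :
    ∀ g : 𝓢(ℝ, ℂ), Disjoint (tsupport f) (tsupport g) →
      ∫ x : ℝ, (x : ℂ) ^ n * (conj (𝓕 f x) * 𝓕 g x) = 0 := by
  induction n with
  | zero =>
    intro g hfg
    have hplancherel := SchwartzMap.integral_inner_fourier_fourier f g
    simp only [RCLike.inner_apply'] at hplancherel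
    simp only [pow_zero, one_mul]
    refine hplancherel.trans (integral_eq_zero_of_ae (Filter.Eventually.of_forall fun x => ?_))
    by_cases hx : x ∈ tsupport f
    · simp [image_eq_zero_of_notMem_tsupport (hfg.notMem_of_mem_left hx)]
    · simp [image_eq_zero_of_notMem_tsupport hx]
  | succ n ih =>
    intro g hfg
    have hzero := ih (SchwartzMap.derivCLM ℂ ℂ g)
      (hfg.mono_right (SchwartzMap.tsupport_derivCLM_subset ℂ g))
    have hrw : ∀ x : ℝ, (x : ℂ) ^ n * (conj (𝓕 f x) * 𝓕 (SchwartzMap.derivCLM ℂ ℂ g) x)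
        = (2 * π * I) * ((x : ℂ) ^ (n + 1) * (conj (𝓕 f x) * 𝓕 g x)) := fun x => by
      rw [SchwartzMap.fourier_derivCLM_apply]
      ring
    simp only [hrw] at hzero
    rw [integral_const_mul] at hzero
    exact (mul_eq_zero.mp hzero).resolve_left Complex.two_pi_I_ne_zero

/-- The Fourier integral with kernel `exp (-ixy)` in terms of Mathlib's Fourier transform. -/
theorem integral_mul_exp_neg_I_mul_eq_fourier (f : ℝ → ℂ) (x : ℝ) :
    ∫ y : ℝ, f y * Complex.exp (-(Complex.I * x * y)) = 𝓕 f (x / (2 * π)) := by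
  rw [Real.fourier_real_eq_integral_exp_smul]
  refine integral_congr_ae (Filter.Eventually.of_forall fun y => ?_)
  have hπ : (π : ℂ) ≠ 0 := by exact_mod_cast Real.pi_ne_zero
  simp only [smul_eq_mul]
  rw [mul_comm]
  congr 2
  push_cast
  field_simp

theorem sq_norm_add_mul_of_norm_one (a b e : ℂ) (he : ‖e‖ = 1) :
    ‖a + e * b‖ ^ 2 = (conj a * a + conj b * b + 2 * e * (conj a * b)).re := by
  have he' : e.re * e.re + e.im * e.im = 1 := by
    rw [← Complex.normSq_apply, Complex.normSq_eq_norm_sq, he, one_pow]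
  simp only [Complex.sq_norm, Complex.normSq_apply, Complex.add_re, Complex.add_im,
    Complex.mul_re, Complex.mul_im, Complex.conj_re, Complex.conj_im, Complex.re_ofNat,
    Complex.im_ofNat]
  linear_combination (b.re ^ 2 + b.im ^ 2) * he'

/-- For smooth compactly supported `f₁, f₂` with disjoint closed
supports and `β ∈ ℝ`, the density `P_β = |F_β|²` of `f_β = f₁ + e^{iβ} f₂` has moments
`∫ xⁿ |F_β(x)|² dx = ∫ xⁿ (|F₁(x)|² + |F₂(x)|²) dx`, independent of `β`. -/
theorem stmt_14 (f₁ f₂ : ℝ → ℂ)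
    (h₁ : ContDiff ℝ (⊤ : ℕ∞) f₁) (h₂ : ContDiff ℝ (⊤ : ℕ∞) f₂)
    (hc₁ : HasCompactSupport f₁) (hc₂ : HasCompactSupport f₂)
    (hdisj : tsupport f₁ ∩ tsupport f₂ = ∅) (β : ℝ)
    (F₁ F₂ Fβ : ℝ → ℂ)
    (hF₁ : F₁ = fun x : ℝ => (1 / Real.sqrt (2 * Real.pi) : ℝ) *
      ∫ y : ℝ, f₁ y * Complex.exp (-(Complex.I * x * y)))
    (hF₂ : F₂ = fun x : ℝ => (1 / Real.sqrt (2 * Real.pi) : ℝ) *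
      ∫ y : ℝ, f₂ y * Complex.exp (-(Complex.I * x * y)))
    (hFβ : Fβ = fun x : ℝ => (1 / Real.sqrt (2 * Real.pi) : ℝ) *
      ∫ y : ℝ, (f₁ y + Complex.exp (Complex.I * β) * f₂ y) *
        Complex.exp (-(Complex.I * x * y))) :
    ∀ n : ℕ, ∫ x : ℝ, x ^ n * ‖Fβ x‖ ^ 2
      = ∫ x : ℝ, x ^ n * (‖F₁ x‖ ^ 2 + ‖F₂ x‖ ^ 2) := by
  intro n
  set g₁ : 𝓢(ℝ, ℂ) := hc₁.toSchwartzMap h₁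
  set g₂ : 𝓢(ℝ, ℂ) := hc₂.toSchwartzMap h₂
  set e : ℂ := Complex.exp (Complex.I * β) with he
  set k : ℝ := 1 / √(2 * π)
  have hnorm : ‖e‖ = 1 := by rw [he, mul_comm, Complex.norm_exp_ofReal_mul_I]
  have hG₁ : ∀ x, F₁ x = k * 𝓕 g₁ (x / (2 * π)) := fun x => by
    simp only [hF₁, integral_mul_exp_neg_I_mul_eq_fourier]
    rfl
  have hG₂ : ∀ x, F₂ x = k * 𝓕 g₂ (x / (2 * π)) := fun x => by
    simp only [hF₂, integral_mul_exp_neg_I_mul_eq_fourier]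
    rfl
  have hGβ : ∀ x, Fβ x = k * (𝓕 g₁ (x / (2 * π)) + e * 𝓕 g₂ (x / (2 * π))) := fun x => by
    have hlin : 𝓕 (g₁ + e • g₂) = 𝓕 g₁ + e • 𝓕 g₂ := by
      rw [FourierTransform.fourier_add, FourierTransform.fourier_smul]
    have happ : 𝓕 (g₁ + e • g₂) (x / (2 * π))
        = 𝓕 g₁ (x / (2 * π)) + e * 𝓕 g₂ (x / (2 * π)) := by
      rw [hlin]
      rfl
    simp only [hFβ, integral_mul_exp_neg_I_mul_eq_fourier fun y => f₁ y + e * f₂ y]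
    rw [← happ]
    rfl
  set P : 𝓢(ℝ, ℂ) → 𝓢(ℝ, ℂ) → ℝ → ℂ :=
    fun f g y => (y : ℂ) ^ n * (conj (𝓕 f y) * 𝓕 g y) with hP
  have hint : ∀ f g, Integrable (P f g) := fun f g =>
    SchwartzMap.integrable_pow_mul_conj_mul (𝓕 f) (𝓕 g) n
  have hcross : ∫ y, P g₁ g₂ y = 0 :=
    SchwartzMap.integral_pow_mul_conj_fourier_mul_fourier_eq_zero g₁ n g₂
      (Set.disjoint_iff_inter_eq_empty.mpr hdisj)
  set D : ℝ → ℂ := fun y => P g₁ g₁ y + P g₂ g₂ y with hD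
  have hDint : Integrable D := (hint g₁ g₁).add (hint g₂ g₂)
  have hCint : Integrable fun y => 2 * e * P g₁ g₂ y := (hint g₁ g₂).const_mul _
  set K : ℝ := (2 * π) ^ n * k ^ 2 with hK
  have hre : ∀ (y : ℝ) (z : ℂ), ((y : ℂ) ^ n * z).re = y ^ n * z.re := fun y z => by
    rw [← Complex.ofReal_pow, Complex.re_ofReal_mul]
  have hscale : ∀ x : ℝ, x ^ n = (2 * π) ^ n * (x / (2 * π)) ^ n := fun x => by
    rw [← mul_pow, mul_div_cancel₀ x Real.two_pi_pos.ne']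
  have hsq : ∀ z : ℂ, ‖(k : ℂ) * z‖ ^ 2 = k ^ 2 * ‖z‖ ^ 2 := fun z => by
    rw [norm_mul, mul_pow, Complex.norm_real, Real.norm_eq_abs, sq_abs]
  have hleft : ∀ x : ℝ, x ^ n * ‖Fβ x‖ ^ 2
      = K * (D (x / (2 * π)) + 2 * e * P g₁ g₂ (x / (2 * π))).re := fun x => by
    rw [hGβ, hsq, sq_norm_add_mul_of_norm_one _ _ _ hnorm, hscale]
    generalize x / (2 * π) = y
    have hfactor : D y + 2 * e * P g₁ g₂ y = (y : ℂ) ^ n * (conj (𝓕 g₁ y) * 𝓕 g₁ y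
        + conj (𝓕 g₂ y) * 𝓕 g₂ y + 2 * e * (conj (𝓕 g₁ y) * 𝓕 g₂ y)) := by
      simp only [hD, hP]
      ring
    rw [hfactor, hre, hK]
    ring
  have hright : ∀ x : ℝ, x ^ n * (‖F₁ x‖ ^ 2 + ‖F₂ x‖ ^ 2)
      = K * (D (x / (2 * π))).re := fun x => by
    rw [hG₁, hG₂, hsq, hsq, hscale]
    generalize x / (2 * π) = y
    have hself : ∀ z : ℂ, (conj z * z).re = ‖z‖ ^ 2 := fun z => by
      rw [← Complex.normSq_eq_conj_mul_self, Complex.ofReal_re, Complex.normSq_eq_norm_sq]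
    simp only [hD, hP, Complex.add_re, hre, hself, hK]
    ring
  simp only [hleft, hright]
  rw [Measure.integral_comp_div (fun y => K * (D y + 2 * e * P g₁ g₂ y).re),
    Measure.integral_comp_div (fun y => K * (D y).re), integral_const_mul, integral_const_mul]
  congr 2
  have hre_add : ∫ y, (D y + 2 * e * P g₁ g₂ y).re = (∫ y, D y + 2 * e * P g₁ g₂ y).re :=
    integral_re (hDint.add hCint)
  have hre_D : ∫ y, (D y).re = (∫ y, D y).re := integral_re hDint
  rw [hre_add, hre_D, integral_add hDint hCint, integral_const_mul, hcross, mul_zero, add_zero]
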